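/- In the generic partition refinement setup, define the canonical cone on the final sequence by ξ^(0) := ! : X → 1 and ξ^(i+1) := H(ξ^(i)) ∘ ξ : X → H^{i+1}1. If the select routine retains all information, i.e., for every i one takes K_{i+1} := X/P_i and k_{i+1} := id (so that q_{i+1} = κ_{P_i}), then for every i ≥ 0 the kernel pair Q_i coincides with the kernel pair of ξ^(i) (each is finer than the other). -/

import Mathlib

open CategoryTheory CategoryTheory.Limits

universe v u

noncomputable section

variable {C : Type u} [Category.{v} C] [HasFiniteLimits C] [HasCoequalizers C]

/-- The kernel pair of `f` is finer than the kernel pair of `g`: there is a morphism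
between the kernel pairs commuting with the projections. -/
def Finer {X A B : C} (f : X ⟶ A) (g : X ⟶ B) : Prop :=
  ∃ m : pullback f f ⟶ pullback g g,
    m ≫ pullback.fst g g = pullback.fst f f ∧ m ≫ pullback.snd g g = pullback.snd f f

variable (H : C ⥤ C) {X : C} (ξ : X ⟶ H.obj X) (K : ℕ → C) (q : ∀ i : ℕ, X ⟶ K i)

/-- `q̄ᵢ = ⟨q₀, …, qᵢ⟩ : X ⟶ ∏_{j ≤ i} K j`. -/
def qbar (i : ℕ) : X ⟶ ∏ᶜ (fun j : Fin (i + 1) => K j) :=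
  Pi.lift fun j => q j

/-- The morphism whose kernel pair is `Qᵢ`. -/
def Qmor (i : ℕ) : X ⟶ ∏ᶜ (fun j : Fin (i + 1) => K j) := qbar K q i

/-- The morphism whose kernel pair is `Pᵢ`. -/
def Pmor (i : ℕ) : X ⟶ H.obj (∏ᶜ (fun j : Fin (i + 1) => K j)) :=
  ξ ≫ H.map (qbar K q i)

/-- `X/Pᵢ`, the coequalizer of the kernel pair `Pᵢ ⇉ X`. -/
def XmodP (i : ℕ) : C :=
  coequalizer (pullback.fst (Pmor H ξ K q i) (Pmor H ξ K q i))
    (pullback.snd (Pmor H ξ K q i) (Pmor H ξ K q i))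

/-- `κ_{Pᵢ} : X ↠ X/Pᵢ`. -/
def kappaP (i : ℕ) : X ⟶ XmodP H ξ K q i :=
  coequalizer.π _ _

/-- `X/Qᵢ`, the coequalizer of the kernel pair `Qᵢ ⇉ X`. -/
def XmodQ (i : ℕ) : C :=
  coequalizer (pullback.fst (Qmor K q i) (Qmor K q i))
    (pullback.snd (Qmor K q i) (Qmor K q i))

/-- `κ_{Qᵢ} : X ↠ X/Qᵢ`. -/
def kappaQ (i : ℕ) : X ⟶ XmodQ K q i :=
  coequalizer.π _ _


/-- `H^i 1`: the `i`-fold application of `H` to the terminal object. -/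
def Hpow : ℕ → C
  | 0 => ⊤_ C
  | i + 1 => H.obj (Hpow i)

/-- The canonical cone `ξ^(i) : X ⟶ H^i 1` on the final sequence:
`ξ^(0) = !` and `ξ^(i+1) = H(ξ^(i)) ∘ ξ`. -/
def xipow : ∀ i : ℕ, X ⟶ Hpow H i
  | 0 => terminal.from X
  | i + 1 => ξ ≫ H.map (xipow i)

theorem finer_iff {X A B : C} {f : X ⟶ A} {g : X ⟶ B} :
    Finer f g ↔ ∀ ⦃Z : C⦄ (a b : Z ⟶ X), a ≫ f = b ≫ f → a ≫ g = b ≫ g := by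
  constructor
  · rintro ⟨m, h₁, h₂⟩ Z a b h
    have hm := pullback.lift a b h ≫= m ≫= pullback.condition (f := g) (g := g)
    rwa [reassoc_of% h₁, reassoc_of% h₂, pullback.lift_fst_assoc, pullback.lift_snd_assoc] at hm
  · intro h
    exact ⟨pullback.lift _ _ (h _ _ pullback.condition), pullback.lift_fst _ _ _,
      pullback.lift_snd _ _ _⟩

theorem Finer.refl {X A : C} (f : X ⟶ A) : Finer f f :=
  finer_iff.2 fun _ _ _ h => h

theorem Finer.trans {X A B D : C} {f : X ⟶ A} {g : X ⟶ B} {h : X ⟶ D}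
    (hfg : Finer f g) (hgh : Finer g h) : Finer f h := by
  rw [finer_iff] at *
  exact fun Z a b e => hgh a b (hfg a b e)

theorem finer_comp {X A B : C} (f : X ⟶ A) (g : A ⟶ B) : Finer f (f ≫ g) :=
  finer_iff.2 fun Z a b e => by rw [reassoc_of% e]

/-- If `f` factors as a regular epimorphism followed by a monomorphism, then applying a
mono-preserving functor preserves the refinement of kernel pairs. -/
theorem Finer.comp_map {H : C ⥤ C}
    (hmono : ∀ {A B : C} (f : A ⟶ B), Mono f → Mono (H.map f))
    {Y X A B I : C} (ξ : Y ⟶ H.obj X) {f : X ⟶ A} {g : X ⟶ B} (hfg : Finer f g)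
    {e : X ⟶ I} {m : I ⟶ A} (he : RegularEpi e) [hm : Mono m] (hem : e ≫ m = f) :
    Finer (ξ ≫ H.map f) (ξ ≫ H.map g) := by
  obtain ⟨h, rfl⟩ : ∃ h, e ≫ h = g :=
    ⟨_, (Cofork.IsColimit.desc' he.isColimit g
      (finer_iff.1 hfg _ _ (by rw [← hem, reassoc_of% he.w]))).2⟩
  subst hem
  have := hmono m hm
  refine finer_iff.2 fun Z a b hab => ?_
  have hab' : a ≫ ξ ≫ H.map e = b ≫ ξ ≫ H.map e := by
    rw [← cancel_mono (H.map m)]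
    simpa using hab
  simpa using hab' =≫ H.map h

theorem finer_coequalizer_π {X A : C} (f : X ⟶ A) :
    Finer f (coequalizer.π (pullback.fst f f) (pullback.snd f f)) :=
  finer_iff.2 fun Z a b h => by
    have hc := pullback.lift a b h ≫= coequalizer.condition (pullback.fst f f) (pullback.snd f f)
    rwa [pullback.lift_fst_assoc, pullback.lift_snd_assoc] at hc

theorem coequalizer_π_finer {X A : C} (f : X ⟶ A) :
    Finer (coequalizer.π (pullback.fst f f) (pullback.snd f f)) f := by
  simpa only [coequalizer.π_desc] using
    finer_comp (coequalizer.π (pullback.fst f f) (pullback.snd f f))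
      (coequalizer.desc f pullback.condition)

theorem finer_qbar_iff {X A : C} {K : ℕ → C} {q : ∀ i : ℕ, X ⟶ K i} {f : X ⟶ A} {i : ℕ} :
    Finer f (qbar K q i) ↔ ∀ j ≤ i, Finer f (q j) := by
  constructor
  · intro h j hj
    have hp : qbar K q i ≫ Pi.π _ (⟨j, Nat.lt_succ_of_le hj⟩ : Fin (i + 1)) = q j :=
      Pi.lift_π _ _
    exact hp ▸ h.trans (finer_comp _ _)
  · intro h
    refine finer_iff.2 fun Z a b hab => Pi.hom_ext _ _ fun j => ?_
    simpa [qbar] using finer_iff.1 (h j (Nat.le_of_lt_succ j.2)) a b hab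

theorem Pmor_finer_Pmor {i j : ℕ} (hji : j ≤ i) :
    Finer (Pmor H ξ K q i) (Pmor H ξ K q j) := by
  have hp : qbar K q i ≫ Pi.lift (fun k : Fin (j + 1) =>
      Pi.π (fun k : Fin (i + 1) => K k) (Fin.castLE (Nat.succ_le_succ hji) k)) =
      qbar K q j := by
    refine Pi.hom_ext _ _ fun k => ?_
    simp [qbar]
  have h := finer_comp (Pmor H ξ K q i) (H.map (Pi.lift (fun k : Fin (j + 1) =>
      Pi.π (fun k : Fin (i + 1) => K k) (Fin.castLE (Nat.succ_le_succ hji) k))))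
  rwa [Pmor, Category.assoc, ← H.map_comp, hp] at h

section RetainAll

variable {H ξ K q}
  (hK : ∀ i : ℕ, K (i + 1) = XmodP H ξ K q i)
  (hq : ∀ i : ℕ, q (i + 1) = kappaP H ξ K q i ≫ eqToHom (hK i).symm)

include hq

theorem Pmor_finer_q_succ (i : ℕ) : Finer (Pmor H ξ K q i) (q (i + 1)) := by
  rw [hq]
  exact (finer_coequalizer_π _).trans (finer_comp _ _)

theorem q_succ_finer_Pmor (i : ℕ) : Finer (q (i + 1)) (Pmor H ξ K q i) := by
  have h := finer_comp (q (i + 1)) (eqToHom (hK i))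
  have hκ : q (i + 1) ≫ eqToHom (hK i) = kappaP H ξ K q i := by simp [hq]
  rw [hκ] at h
  exact h.trans (coequalizer_π_finer _)

theorem Pmor_finer_qbar_succ (hK0 : IsTerminal (K 0)) (i : ℕ) :
    Finer (Pmor H ξ K q i) (qbar K q (i + 1)) := by
  refine finer_qbar_iff.2 fun j hj => ?_
  cases j with
  | zero => exact finer_iff.2 fun Z a b _ => hK0.hom_ext _ _
  | succ j =>
    exact (Pmor_finer_Pmor H ξ K q (Nat.le_of_succ_le_succ hj)).trans (Pmor_finer_q_succ hK hq j)

theorem qbar_succ_finer_Pmor (i : ℕ) : Finer (qbar K q (i + 1)) (Pmor H ξ K q i) :=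
  (finer_qbar_iff.1 (Finer.refl _) _ le_rfl).trans (q_succ_finer_Pmor hK hq i)

end RetainAll

/-- **The final-chain corner case.**  In the generic partition refinement setup, if the
select routine retains all information, i.e. `K_{i+1} := X/Pᵢ` and `k_{i+1} := id`
(so that `q_{i+1} = κ_{Pᵢ}`), then for every `i ≥ 0` the kernel pair `Qᵢ` coincides with
the kernel pair of the canonical cone morphism `ξ^(i) : X ⟶ H^i 1` (each is finer than
the other). -/
theorem stmt_7
    (hfact : ∀ {A B : C} (f : A ⟶ B), ∃ (I : C) (e : A ⟶ I) (m : I ⟶ B),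
      Nonempty (RegularEpi e) ∧ Mono m ∧ e ≫ m = f)
    (hmono : ∀ {A B : C} (f : A ⟶ B), Mono f → Mono (H.map f))
    (hK0 : IsTerminal (K 0))
    (hK : ∀ i : ℕ, K (i + 1) = XmodP H ξ K q i)
    (hq : ∀ i : ℕ, q (i + 1) = kappaP H ξ K q i ≫ eqToHom (hK i).symm) :
    ∀ i : ℕ, Finer (Qmor K q i) (xipow H ξ i) ∧ Finer (xipow H ξ i) (Qmor K q i) := by
  have hmap {A B : C} {f : X ⟶ A} {g : X ⟶ B} (hfg : Finer f g) :
      Finer (ξ ≫ H.map f) (ξ ≫ H.map g) := by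
    obtain ⟨I, e, m, ⟨he⟩, hm, hem⟩ := hfact f
    exact hfg.comp_map hmono ξ he hem
  intro i
  induction i with
  | zero =>
    refine ⟨finer_iff.2 fun Z a b _ => terminalIsTerminal.hom_ext _ _,
      finer_qbar_iff.2 fun j hj => ?_⟩
    obtain rfl := Nat.le_zero.1 hj
    exact finer_iff.2 fun Z a b _ => hK0.hom_ext _ _
  | succ i ih =>
    exact ⟨(qbar_succ_finer_Pmor hK hq i).trans (hmap ih.1),
      (hmap ih.2).trans (Pmor_finer_qbar_succ hK hq hK0 i)⟩

end
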